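/- arXiv:2411.02173 — 2 statements merged into one kernel-verified Lean document; each statement's English description precedes it below -/
import Mathlib

section
/- The direct limit of the ℕ-indexed system ℤ² → ℤ² → ℤ² → ⋯, in which every bonding map is the homomorphism A(x,y) = (3x, x + 2y), is isomorphic as an abelian group to ℤ[1/3] × ℤ[1/2]. -/
/-- `ℤ[1/k]`: the additive subgroup `{m / kⁿ : m ∈ ℤ, n ∈ ℕ}` of `ℚ`,
described as the set of rationals `q` with `q * kⁿ ∈ ℤ` for some `n`. -/
def ZOneOver (k : ℕ) : AddSubgroup ℚ where
  carrier := {q : ℚ | ∃ (m : ℤ) (n : ℕ), q * (k : ℚ) ^ n = (m : ℚ)}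
  zero_mem' := ⟨0, 0, by norm_num⟩
  add_mem' := by
    rintro a b ⟨m₁, n₁, h₁⟩ ⟨m₂, n₂, h₂⟩
    exact ⟨m₁ * (k : ℤ) ^ n₂ + m₂ * (k : ℤ) ^ n₁, n₁ + n₂, by
      push_cast
      linear_combination (k : ℚ) ^ n₂ * h₁ + (k : ℚ) ^ n₁ * h₂⟩
  neg_mem' := by
    rintro a ⟨m, n, h⟩
    exact ⟨-m, n, by push_cast; linear_combination -h⟩

/-- The homomorphism `m ↦ m / kⁱ` from `ℤ` to `ℤ[1/k]`. -/
def ZOneOver.divPow (k : ℕ) [NeZero k] (i : ℕ) : ℤ →+ ZOneOver k where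
  toFun m := ⟨m / (k : ℚ) ^ i, m, i,
    div_mul_cancel₀ _ (pow_ne_zero i (NeZero.ne (k : ℚ)))⟩
  map_zero' := by ext; simp
  map_add' a b := by ext; simp [add_div]

theorem ZOneOver.coe_divPow (k : ℕ) [NeZero k] (i : ℕ) (m : ℤ) :
    (ZOneOver.divPow k i m : ℚ) = m / (k : ℚ) ^ i := rfl

theorem ZOneOver.divPow_injective (k : ℕ) [NeZero k] (i : ℕ) :
    Function.Injective (ZOneOver.divPow k i) := by
  intro a b h
  have h' := congrArg Subtype.val h
  rw [ZOneOver.coe_divPow, ZOneOver.coe_divPow,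
    div_left_inj' (pow_ne_zero i (NeZero.ne (k : ℚ)))] at h'
  exact_mod_cast h'

theorem ZOneOver.divPow_add (k : ℕ) [NeZero k] (i j : ℕ) (m : ℤ) :
    ZOneOver.divPow k (i + j) ((k : ℤ) ^ j * m) = ZOneOver.divPow k i m := by
  have hk : (k : ℚ) ≠ 0 := NeZero.ne _
  ext
  simp only [ZOneOver.coe_divPow]
  push_cast
  field_simp
  ring

theorem ZOneOver.divPow_succ (k : ℕ) [NeZero k] (i : ℕ) (m : ℤ) :
    ZOneOver.divPow k (i + 1) (k * m) = ZOneOver.divPow k i m := by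
  simpa using ZOneOver.divPow_add k i 1 m

theorem ZOneOver.exists_divPow_eq (k : ℕ) [NeZero k] (q : ZOneOver k) :
    ∃ (i : ℕ) (m : ℤ), ZOneOver.divPow k i m = q := by
  obtain ⟨q, m, i, h⟩ := q
  refine ⟨i, m, Subtype.ext ?_⟩
  exact (div_eq_iff (pow_ne_zero i (NeZero.ne (k : ℚ)))).2 h.symm

/-- The homomorphism `(x, y) ↦ (x / 3ⁱ, (y - x) / 2ⁱ)` diagonalizing the `i`-th stage. -/
def stageHom (i : ℕ) : ℤ × ℤ →+ ZOneOver 3 × ZOneOver 2 :=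
  ((ZOneOver.divPow 3 i).comp (AddMonoidHom.fst ℤ ℤ)).prod
    ((ZOneOver.divPow 2 i).comp (AddMonoidHom.snd ℤ ℤ - AddMonoidHom.fst ℤ ℤ))

theorem stageHom_apply (i : ℕ) (x y : ℤ) :
    stageHom i (x, y) = (ZOneOver.divPow 3 i x, ZOneOver.divPow 2 i (y - x)) := rfl

theorem stageHom_succ (i : ℕ) (x y : ℤ) :
    stageHom (i + 1) (3 * x, x + 2 * y) = stageHom i (x, y) := by
  rw [stageHom_apply, stageHom_apply, show x + 2 * y - 3 * x = 2 * (y - x) by ring]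
  exact Prod.ext (ZOneOver.divPow_succ 3 i x) (ZOneOver.divPow_succ 2 i (y - x))

theorem stageHom_injective (i : ℕ) : Function.Injective (stageHom i) := by
  rintro ⟨a, b⟩ ⟨c, d⟩ h
  rw [stageHom_apply, stageHom_apply, Prod.mk.injEq] at h
  have h₁ := ZOneOver.divPow_injective 3 i h.1
  have h₂ := ZOneOver.divPow_injective 2 i h.2
  ext <;> dsimp only <;> omega

theorem exists_stageHom_eq (p : ZOneOver 3 × ZOneOver 2) :
    ∃ (i : ℕ) (v : ℤ × ℤ), stageHom i v = p := by
  obtain ⟨p, q⟩ := p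
  obtain ⟨i, a, rfl⟩ := ZOneOver.exists_divPow_eq 3 p
  obtain ⟨j, b, rfl⟩ := ZOneOver.exists_divPow_eq 2 q
  refine ⟨i + j, (3 ^ j * a, 3 ^ j * a + 2 ^ i * b), ?_⟩
  rw [stageHom_apply, add_sub_cancel_left]
  refine Prod.ext (ZOneOver.divPow_add 3 i j a) ?_
  rw [add_comm i j]
  exact ZOneOver.divPow_add 2 j i b

/-- The direct limit of `ℤ² → ℤ² → ℤ² → ⋯` with every bonding map
`A (x, y) = (3x, x + 2y)` is isomorphic as an abelian group to `ℤ[1/3] × ℤ[1/2]`. -/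
theorem directLimit_A_iso_zOneOver3_prod_zOneOver2
    (f : ∀ i j : ℕ, i ≤ j → ℤ × ℤ →+ ℤ × ℤ)
    (hf : ∀ (i : ℕ) (x y : ℤ), f i (i + 1) (Nat.le_succ i) (x, y) = (3 * x, x + 2 * y))
    [DirectedSystem (fun _ : ℕ => ℤ × ℤ) fun i j h => f i j h] :
    Nonempty
      (AddCommGroup.DirectLimit (fun _ : ℕ => ℤ × ℤ) f ≃+ (ZOneOver 3 × ZOneOver 2)) := by
  have compat : ∀ i j (hij : i ≤ j) (v : ℤ × ℤ), stageHom j (f i j hij v) = stageHom i v := by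
    intro i j hij v
    induction j, hij using Nat.le_induction with
    | base => rw [DirectedSystem.map_self (f := fun i j h => f i j h)]
    | succ j hij ih =>
      rw [← DirectedSystem.map_map (f := fun i j h => f i j h) hij (Nat.le_succ j) v, ← ih]
      exact (congrArg _ (hf j _ _)).trans (stageHom_succ j _ _)
  refine ⟨AddEquiv.ofBijective
    (AddCommGroup.DirectLimit.lift (fun _ : ℕ => ℤ × ℤ) f _ stageHom compat) ⟨?_, ?_⟩⟩
  · exact AddCommGroup.DirectLimit.lift_injective _ _ _ stageHom_injective
  · intro p
    obtain ⟨i, v, rfl⟩ := exists_stageHom_eq p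
    exact ⟨AddCommGroup.DirectLimit.of _ f i v, AddCommGroup.DirectLimit.lift_of _ _ _ _ _⟩
end

section
/- Let A : ℤ² → ℤ² be the group homomorphism A(x,y) = (3x, x + 2y). Then for every n ≥ 1 and all (x,y) ∈ ℤ², the n-th iterate satisfies Aⁿ(x,y) = (3ⁿx, (3ⁿ − 2ⁿ)x + 2ⁿy). Consequently, for all integers x ≥ 0 and y ≥ 1 there exists N ∈ ℕ such that for every n ≥ N both coordinates of Aⁿ(y,0) − Aⁿ(0,x) are nonnegative. -/
theorem add_two_mul_two_pow_le (n : ℕ) : ((n : ℤ) + 2) * 2 ^ n ≤ 2 * 3 ^ n := by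
  induction n with
  | zero => norm_num
  | succ k ih =>
    have h : (0 : ℤ) ≤ k * 2 ^ k := by positivity
    push_cast
    rw [pow_succ, pow_succ]
    linarith

theorem iterate_apply_of_apply_eq {A : ℤ × ℤ → ℤ × ℤ}
    (hA : ∀ x y : ℤ, A (x, y) = (3 * x, x + 2 * y)) (n : ℕ) (x y : ℤ) :
    A^[n] (x, y) = (3 ^ n * x, (3 ^ n - 2 ^ n) * x + 2 ^ n * y) := by
  induction n with
  | zero => simp
  | succ k ih =>
    rw [Function.iterate_succ_apply', ih, hA]
    ext <;> ring


/-- For `A : ℤ² → ℤ²`, `A (x, y) = (3x, x + 2y)`: for every `n ≥ 1` the `n`-th iterate is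
`Aⁿ (x, y) = (3ⁿ x, (3ⁿ − 2ⁿ) x + 2ⁿ y)`; consequently, for all integers `x ≥ 0`, `y ≥ 1`
there is `N` such that for all `n ≥ N` both coordinates of `Aⁿ (y, 0) − Aⁿ (0, x)` are
nonnegative. -/
theorem iterate_formula_and_eventual_domination
    (A : ℤ × ℤ →+ ℤ × ℤ)
    (hA : ∀ x y : ℤ, A (x, y) = (3 * x, x + 2 * y)) :
    (∀ n : ℕ, 1 ≤ n → ∀ x y : ℤ,
        (⇑A)^[n] (x, y) = (3 ^ n * x, (3 ^ n - 2 ^ n) * x + 2 ^ n * y)) ∧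
      ∀ x y : ℤ, 0 ≤ x → 1 ≤ y → ∃ N : ℕ, ∀ n : ℕ, N ≤ n →
        0 ≤ ((⇑A)^[n] (y, 0) - (⇑A)^[n] (0, x)).1 ∧
        0 ≤ ((⇑A)^[n] (y, 0) - (⇑A)^[n] (0, x)).2 := by
  refine ⟨fun n _ => iterate_apply_of_apply_eq hA n, fun x y hx hy => ⟨2 * x.toNat, fun n hn => ?_⟩⟩
  simp only [iterate_apply_of_apply_eq hA, Prod.fst_sub, Prod.snd_sub, mul_zero, add_zero,
    sub_zero, zero_add]
  refine ⟨by positivity, ?_⟩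
  have hxn : 2 * x ≤ n := by omega
  have hpow := add_two_mul_two_pow_le n
  have hmul : 2 * x * 2 ^ n ≤ n * 2 ^ n := by gcongr
  have hx_pow : 0 ≤ x * 2 ^ n := by positivity
  have hsub : (0 : ℤ) ≤ 3 ^ n - 2 ^ n := by linarith
  have hy_mul := le_mul_of_one_le_right hsub hy
  linarith
end
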